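/- For all k, m, n ∈ ℕ there exists p ∈ ℕ, depending only on k, m and n, such that for every M ∈ K and every finite subset A ⊆ M with |A| = k, cl^m_M(cl^n_M(A)) ⊆ cl^p_M(A). -/

import Mathlib

open FirstOrder Filter Topology
open scoped Classical

/-- The finite relational language with relation symbols `R i` of arity `k i`, for `i : Fin p`. -/
def Lang (p : ℕ) (k : Fin p → ℕ) : FirstOrder.Language where
  Functions := fun _ => Empty
  Relations := fun n => { i : Fin p // k i = n }

variable {p : ℕ}

section StructureDefs

/-- The relation `R i` holds on the finite set `C` (set-version of the relation). -/
def HoldsOn (k : Fin p → ℕ) {M : Type*} [(Lang p k).Structure M]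
    (i : Fin p) (C : Finset M) : Prop :=
  ∃ v : Fin (k i) → M, Function.Injective v ∧ Finset.image v Finset.univ = C ∧
    Language.Structure.RelMap (L := Lang p k) (⟨i, rfl⟩ : (Lang p k).Relations (k i)) v

/-- `w i A` : the number of `k i`-element subsets of `A` on which `R i` holds. -/
noncomputable def w (k : Fin p → ℕ) {M : Type*} [(Lang p k).Structure M]
    (i : Fin p) (A : Finset M) : ℕ :=
  Set.ncard {C : Finset M | C ⊆ A ∧ C.card = k i ∧ HoldsOn k i C}

/-- `e(A) = Σ_i α_i · w_i(A)`. -/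
noncomputable def eVal (k : Fin p → ℕ) (α : Fin p → ℝ) {M : Type*} [(Lang p k).Structure M]
    (A : Finset M) : ℝ :=
  ∑ i : Fin p, α i * (w k i A : ℝ)

/-- `δ(A) = |A| − e(A)`. -/
noncomputable def delta (k : Fin p → ℕ) (α : Fin p → ℝ) {M : Type*} [(Lang p k).Structure M]
    (A : Finset M) : ℝ :=
  (A.card : ℝ) - eVal k α A

/-- A structure is symmetric and irreflexive: relations hold only on tuples of pairwise
distinct elements and are invariant under permutations of the tuple. -/
def SymmIrr (k : Fin p → ℕ) (M : Type*) [(Lang p k).Structure M] : Prop :=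
  (∀ (n : ℕ) (r : (Lang p k).Relations n) (v : Fin n → M),
      Language.Structure.RelMap r v → Function.Injective v) ∧
  (∀ (n : ℕ) (r : (Lang p k).Relations n) (v : Fin n → M) (σ : Equiv.Perm (Fin n)),
      Language.Structure.RelMap r v → Language.Structure.RelMap r (v ∘ σ))

/-- Membership in the class `K`: a symmetric irreflexive structure all of whose finite
substructures have (hereditarily) nonnegative `δ`. -/
def InK (k : Fin p → ℕ) (α : Fin p → ℝ) (M : Type*) [(Lang p k).Structure M] : Prop :=
  SymmIrr k M ∧ ∀ A : Finset M, 0 ≤ delta k α A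

/-- A finite structure is in `K_α` if it is symmetric irreflexive and `δ(A) ≥ 0` for every
substructure. -/
def InKalpha (k : Fin p → ℕ) (α : Fin p → ℝ) (B : Type*) [(Lang p k).Structure B] : Prop :=
  SymmIrr k B ∧ ∀ S : Finset B, 0 ≤ delta k α S

/-- `d_B(X) = inf { δ(Y) : X ⊆ Y ⊆ B }` (relative version, inside the finite set `B`). -/
noncomputable def dRel (k : Fin p → ℕ) (α : Fin p → ℝ) {M : Type*} [(Lang p k).Structure M]
    (B X : Finset M) : ℝ :=
  sInf {r : ℝ | ∃ Y : Finset M, X ⊆ Y ∧ Y ⊆ B ∧ r = delta k α Y}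

/-- `A ≤_s B` for finite sets: `A ⊆ B` and `d_A(X) = d_B(X)` for all `X ⊆ A`. -/
def StrongIn (k : Fin p → ℕ) (α : Fin p → ℝ) {M : Type*} [(Lang p k).Structure M]
    (A B : Finset M) : Prop :=
  A ⊆ B ∧ ∀ X : Finset M, X ⊆ A → dRel k α A X = dRel k α B X

/-- `A ≤_i B` (intrinsic extension): there is no `A'` with `A ⊆ A' ⊊ B` and `A' ≤_s B`. -/
def IntrinsicIn (k : Fin p → ℕ) (α : Fin p → ℝ) {M : Type*} [(Lang p k).Structure M]
    (A B : Finset M) : Prop :=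
  A ⊆ B ∧ ∀ A' : Finset M, A ⊆ A' → A' ⊂ B → ¬ StrongIn k α A' B

/-- `cl^m_M(A)`: the union of all `B ⊆ M` with `A ≤_i B` and `|B − A| < m`. -/
def cl (k : Fin p → ℕ) (α : Fin p → ℝ) {M : Type*} [(Lang p k).Structure M]
    (m : ℕ) (A : Finset M) : Set M :=
  {x : M | ∃ B : Finset M, IntrinsicIn k α A B ∧ (B \ A).card < m ∧ x ∈ B}

/-- `C` and `B'` are freely joined over `A` (inside the ambient structure): they intersect in
`A` and every relation on a subset of `C ∪ B'` lives entirely inside `C` or inside `B'`. -/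
def FreelyJoined (k : Fin p → ℕ) {M : Type*} [(Lang p k).Structure M]
    (A C B' : Set M) : Prop :=
  C ∩ B' = A ∧
    ∀ (i : Fin p) (S : Finset M), ↑S ⊆ C ∪ B' → HoldsOn k i S → (↑S ⊆ C ∨ ↑S ⊆ B')

/-- `g` is an embedding (of relational structures). -/
def IsEmb (k : Fin p → ℕ) {M N : Type*} [(Lang p k).Structure M] [(Lang p k).Structure N]
    (g : M → N) : Prop :=
  Function.Injective g ∧
    ∀ (n : ℕ) (r : (Lang p k).Relations n) (v : Fin n → M),
      (Language.Structure.RelMap r (g ∘ v) ↔ Language.Structure.RelMap r v)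

/-- `g` restricted to `A` is an embedding of the substructure on `A`. -/
def IsEmbOn (k : Fin p → ℕ) {M N : Type*} [(Lang p k).Structure M] [(Lang p k).Structure N]
    (A : Finset M) (g : M → N) : Prop :=
  Set.InjOn g ↑A ∧
    ∀ (n : ℕ) (r : (Lang p k).Relations n) (v : Fin n → M), (∀ j, v j ∈ A) →
      (Language.Structure.RelMap r (g ∘ v) ↔ Language.Structure.RelMap r v)

/-- `h` restricts to an isomorphism from the induced structure on `S` onto `S'`. -/
def IsIsoOn (k : Fin p → ℕ) {M N : Type*} [(Lang p k).Structure M] [(Lang p k).Structure N]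
    (S : Set M) (S' : Set N) (h : M → N) : Prop :=
  Set.InjOn h S ∧ h '' S = S' ∧
    ∀ (n : ℕ) (r : (Lang p k).Relations n) (v : Fin n → M), (∀ j, v j ∈ S) →
      (Language.Structure.RelMap r (h ∘ v) ↔ Language.Structure.RelMap r v)

/-- A countable structure `M ∈ K` is `(K_α, ≤_s)`-semigeneric if for every `A ≤_s B` with
`B ∈ K_α` finite and every embedding `g` of `A` into `M`, and each `m`, there is an embedding
`ĝ` of `B` into `M` extending `g` whose image adds nothing to the `m`-closure of `gA` and is
freely joined with `cl^m(gA)` over `gA`. -/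
def Semigeneric (k : Fin p → ℕ) (α : Fin p → ℝ) (M : Type*) [(Lang p k).Structure M] : Prop :=
  Countable M ∧ InK k α M ∧
    ∀ (B : Type) (_ : Fintype B) (_ : (Lang p k).Structure B), InKalpha k α B →
      ∀ A : Finset B, StrongIn k α A Finset.univ →
        ∀ g : B → M, IsEmbOn k A g → ∀ m : ℕ,
          ∃ g' : B → M, IsEmb k g' ∧ (∀ a ∈ A, g' a = g a) ∧
            cl k α m (Finset.image g' Finset.univ) =
              ↑(Finset.image g' Finset.univ) ∪ cl k α m (Finset.image g A) ∧
            FreelyJoined k (↑(Finset.image g A) : Set M) (cl k α m (Finset.image g A))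
              (↑(Finset.image g' Finset.univ))

end StructureDefs

section FormulaDefs

/-- A formula is existential if it is an existential quantifier prefix applied to a
quantifier-free formula. -/
def IsExistential (k : Fin p → ℕ) {r : ℕ} (φ : (Lang p k).Formula (Fin r)) : Prop :=
  ∃ (m : ℕ) (ψ : (Lang p k).BoundedFormula (Fin r) m), ψ.IsQF ∧ φ = ψ.exs

/-- Boolean combinations of existential formulas. -/
inductive IsBoolCombExistential (k : Fin p → ℕ) {r : ℕ} :
    (Lang p k).Formula (Fin r) → Prop
  | of_existential (φ) : IsExistential k φ → IsBoolCombExistential k φ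
  | not (φ) : IsBoolCombExistential k φ → IsBoolCombExistential k φ.not
  | inf (φ ψ) : IsBoolCombExistential k φ → IsBoolCombExistential k ψ →
      IsBoolCombExistential k (φ ⊓ ψ)

end FormulaDefs

section Probability

/-- A configuration of potential relations on `{1,…,n}`: for each relation symbol, a Boolean
choice on each finite subset. -/
abbrev Config (p n : ℕ) := (i : Fin p) → Finset (Fin n) → Bool

/-- The valid configurations: `R i` may only hold on sets of size `k i`. -/
noncomputable def validE (k : Fin p → ℕ) (n : ℕ) : Finset (Config p n) :=
  Finset.univ.filter (fun E => ∀ (i : Fin p) (C : Finset (Fin n)), E i C = true → C.card = k i)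

/-- The probability of the configuration `E`: independently for each `i` and each
`k i`-element set `C`, the relation `R i` holds on `C` with probability `γ i · n^{-α i}`. -/
noncomputable def weight (k : Fin p → ℕ) (α γ : Fin p → ℝ) (n : ℕ) (E : Config p n) : ℝ :=
  ∏ i : Fin p, ∏ C ∈ Finset.univ.filter (fun C : Finset (Fin n) => C.card = k i),
    (if E i C = true then γ i * (n : ℝ) ^ (-(α i)) else 1 - γ i * (n : ℝ) ^ (-(α i)))

/-- The probability `P_n` of an event (a set of configurations). -/
noncomputable def Pev (k : Fin p → ℕ) (α γ : Fin p → ℝ) (n : ℕ)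
    (Q : Config p n → Prop) : ℝ :=
  ∑ E ∈ validE k n, if Q E then weight k α γ n E else 0

/-- The random `L⁺`-structure `G_n` on `Fin n` determined by the configuration `E`. -/
def structOf (k : Fin p → ℕ) (n : ℕ) (E : Config p n) : (Lang p k).Structure (Fin n) where
  funMap := fun {_} f _ => f.elim
  RelMap := fun {_} r v => Function.Injective v ∧ E r.1 (Finset.image v Finset.univ) = true

/-- The probability that `G_n ⊨ φ`. -/
noncomputable def Pn (k : Fin p → ℕ) (α γ : Fin p → ℝ) (n : ℕ)
    (φ : (Lang p k).Sentence) : ℝ :=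
  Pev k α γ n (fun E => letI := structOf k n E; (Fin n) ⊨ φ)

/-- The Irrationality Hypothesis: `α_0, …, α_{p−1}, 1` are linearly independent over `ℚ`. -/
def IrrHyp (α : Fin p → ℝ) : Prop :=
  LinearIndependent ℚ (Fin.snoc α (1 : ℝ) : Fin (p + 1) → ℝ)

/-- The almost sure theory `T^α`: the sentences with limit probability 1. -/
noncomputable def Talpha (k : Fin p → ℕ) (α γ : Fin p → ℝ) : (Lang p k).Theory :=
  {φ : (Lang p k).Sentence | Tendsto (fun n => Pn k α γ n φ) atTop (𝓝 1)}

/-- Auxiliary: `M`, equipped with the structure `S`, satisfies the sentence `φ`. -/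
def RealizeS (k : Fin p → ℕ) (M : Type*) (S : (Lang p k).Structure M)
    (φ : (Lang p k).Sentence) : Prop :=
  letI := S; M ⊨ φ

/-- Auxiliary: `M`, equipped with the structure `S`, is a model of the theory `T`. -/
def ModelsT (k : Fin p → ℕ) (M : Type*) (S : (Lang p k).Structure M)
    (T : (Lang p k).Theory) : Prop :=
  ∀ φ ∈ T, RealizeS k M S φ

end Probability

section Predimension

variable (k : Fin p → ℕ) (α : Fin p → ℝ) {M : Type*} [(Lang p k).Structure M]

theorem finite_setOf_holdsOn (i : Fin p) (A : Finset M) :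
    {C : Finset M | C ⊆ A ∧ C.card = k i ∧ HoldsOn k i C}.Finite :=
  A.powerset.finite_toSet.subset fun _ hC => Finset.mem_powerset.2 hC.1

theorem w_le_two_pow_card (i : Fin p) (A : Finset M) : w k i A ≤ 2 ^ A.card := by
  rw [← Finset.card_powerset, ← Set.ncard_coe_finset]
  exact Set.ncard_le_ncard (fun _ hC => Finset.mem_powerset.2 hC.1) A.powerset.finite_toSet

theorem w_add_w_le (i : Fin p) (A B : Finset M) :
    w k i A + w k i B ≤ w k i (A ∪ B) + w k i (A ∩ B) := by
  unfold w
  rw [← Set.ncard_union_add_ncard_inter _ _ (finite_setOf_holdsOn k i A)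
    (finite_setOf_holdsOn k i B)]
  refine add_le_add (Set.ncard_le_ncard ?_ (finite_setOf_holdsOn k i _))
    (Set.ncard_le_ncard ?_ (finite_setOf_holdsOn k i _))
  · rintro C (⟨h, h'⟩ | ⟨h, h'⟩)
    · exact ⟨h.trans Finset.subset_union_left, h'⟩
    · exact ⟨h.trans Finset.subset_union_right, h'⟩
  · rintro C ⟨⟨h, h'⟩, ⟨h₂, -⟩⟩
    exact ⟨Finset.subset_inter h h₂, h'⟩

theorem delta_le_card (hα : ∀ i, 0 ≤ α i) (A : Finset M) : delta k α A ≤ A.card :=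
  sub_le_self _ (Finset.sum_nonneg fun i _ => mul_nonneg (hα i) (Nat.cast_nonneg _))

/-- The predimension is submodular. -/
theorem delta_union_add_delta_inter_le (hα : ∀ i, 0 ≤ α i) (A B : Finset M) :
    delta k α (A ∪ B) + delta k α (A ∩ B) ≤ delta k α A + delta k α B := by
  have hcard : ((A ∪ B).card : ℝ) + (A ∩ B).card = A.card + B.card :=
    mod_cast Finset.card_union_add_card_inter A B
  have he : eVal k α A + eVal k α B ≤ eVal k α (A ∪ B) + eVal k α (A ∩ B) := by
    unfold eVal
    rw [← Finset.sum_add_distrib, ← Finset.sum_add_distrib]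
    refine Finset.sum_le_sum fun i _ => ?_
    rw [← mul_add, ← mul_add]
    exact mul_le_mul_of_nonneg_left (mod_cast w_add_w_le k i A B) (hα i)
  unfold delta
  linarith

/-- Sets of bounded size have only finitely many predimensions, uniformly in the structure, so
strict decreases of the predimension between such sets are bounded away from zero. -/
theorem exists_pos_delta_add_le (N : ℕ) :
    ∃ ε : ℝ, 0 < ε ∧ ∀ (M : Type*) [(Lang p k).Structure M] (A B : Finset M),
      A.card ≤ N → B.card ≤ N → delta k α B < delta k α A →
        delta k α B + ε ≤ delta k α A := by
  let V : Set ℝ := Set.range fun z : Fin (N + 1) × (Fin p → Fin (2 ^ N + 1)) =>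
    ((z.1 : ℕ) : ℝ) - ∑ i, α i * ((z.2 i : ℕ) : ℝ)
  let D : Set ℝ := ((fun z : ℝ × ℝ => z.1 - z.2) '' V ×ˢ V) ∩ Set.Ioi 0
  have hV : V.Finite := Set.finite_range _
  have hD : D.Finite := ((hV.prod hV).image _).inter_of_left _
  have hmem : ∀ (M : Type _) [(Lang p k).Structure M] (A : Finset M),
      A.card ≤ N → delta k α A ∈ V := fun M _ A hA =>
    ⟨(⟨A.card, by omega⟩, fun i => ⟨w k i A, Nat.lt_succ_of_le
      ((w_le_two_pow_card k i A).trans (Nat.pow_le_pow_right two_pos hA))⟩), rfl⟩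
  obtain ⟨ε, hε, hlb⟩ : ∃ ε : ℝ, 0 < ε ∧ ∀ x ∈ D, ε ≤ x := by
    rcases D.eq_empty_or_nonempty with h | h
    · exact ⟨1, one_pos, by simp [h]⟩
    · obtain ⟨x, hx, hmin⟩ := Set.exists_min_image D id hD h
      exact ⟨x, hx.2, hmin⟩
  refine ⟨ε, hε, fun M _ A B hA hB hlt => ?_⟩
  have := hlb (delta k α A - delta k α B)
    ⟨⟨(_, _), ⟨hmem M A hA, hmem M B hB⟩, rfl⟩, sub_pos.2 hlt⟩
  linarith

end Predimension

section IntrinsicExtension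

variable {k : Fin p → ℕ} {α : Fin p → ℝ} {M : Type*} [(Lang p k).Structure M]

theorem strongIn_of_forall_delta_le (hα : ∀ i, 0 ≤ α i) {A B : Finset M} (hAB : A ⊆ B)
    (h : ∀ Y, A ⊆ Y → Y ⊆ B → delta k α A ≤ delta k α Y) : StrongIn k α A B := by
  have hbdd (A X : Finset M) :
      BddBelow {r : ℝ | ∃ Y : Finset M, X ⊆ Y ∧ Y ⊆ A ∧ r = delta k α Y} := by
    refine ((A.powerset.finite_toSet.image (delta k α)).subset ?_).bddBelow
    rintro r ⟨Y, -, hY, rfl⟩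
    exact ⟨Y, Finset.mem_powerset.2 hY, rfl⟩
  refine ⟨hAB, fun X hX => le_antisymm ?_ ?_⟩
  · refine le_csInf ⟨_, X, subset_rfl, hX.trans hAB, rfl⟩ ?_
    rintro r ⟨Y, hXY, hYB, rfl⟩
    refine (csInf_le (hbdd A X) ⟨A ∩ Y, Finset.subset_inter hX hXY,
      Finset.inter_subset_left, rfl⟩).trans ?_
    have h₁ := h (A ∪ Y) Finset.subset_union_left (Finset.union_subset hAB hYB)
    have h₂ := delta_union_add_delta_inter_le k α hα A Y
    linarith
  · refine csInf_le_csInf (hbdd B X) ⟨_, X, subset_rfl, hX, rfl⟩ ?_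
    rintro r ⟨Y, hXY, hYA, rfl⟩
    exact ⟨Y, hXY, hYA.trans hAB, rfl⟩

theorem StrongIn.delta_le {A B : Finset M} (h : StrongIn k α A B) :
    delta k α A ≤ delta k α B := by
  have hA : dRel k α A A = delta k α A := by
    have : {r : ℝ | ∃ Y : Finset M, A ⊆ Y ∧ Y ⊆ A ∧ r = delta k α Y} = {delta k α A} := by
      ext r
      constructor
      · rintro ⟨Y, h₁, h₂, rfl⟩
        rw [h₁.antisymm h₂]
        rfl
      · rintro rfl
        exact ⟨A, subset_rfl, subset_rfl, rfl⟩
    rw [dRel, this, csInf_singleton]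
  rw [← hA, h.2 A subset_rfl]
  refine csInf_le ((B.powerset.finite_toSet.image (delta k α)).subset ?_).bddBelow
    ⟨B, h.1, subset_rfl, rfl⟩
  rintro r ⟨Y, -, hY, rfl⟩
  exact ⟨Y, Finset.mem_powerset.2 hY, rfl⟩

theorem intrinsicIn_iff_delta_lt (hα : ∀ i, 0 ≤ α i) {A B : Finset M} :
    IntrinsicIn k α A B ↔
      A ⊆ B ∧ ∀ A' : Finset M, A ⊆ A' → A' ⊂ B → delta k α B < delta k α A' := by
  refine ⟨fun h => ⟨h.1, fun A' hA hB => ?_⟩,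
    fun h => ⟨h.1, fun A' hA hB hs => (h.2 A' hA hB).not_ge hs.delta_le⟩⟩
  by_contra! hle
  -- a minimizer of the predimension among the proper subsets of `B` containing `A` is strong
  let P : Finset (Finset M) := B.ssubsets.filter (A ⊆ ·)
  obtain ⟨Y, hY, hmin⟩ := P.exists_min_image (delta k α)
    ⟨A', Finset.mem_filter.2 ⟨Finset.mem_ssubsets.2 hB, hA⟩⟩
  have hYB := Finset.mem_ssubsets.1 (Finset.mem_filter.1 hY).1
  have hAY := (Finset.mem_filter.1 hY).2
  refine h.2 Y hAY hYB (strongIn_of_forall_delta_le hα hYB.1 fun Z hYZ hZB => ?_)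
  rcases hZB.eq_or_ssubset with rfl | hZ
  · exact (hmin A' (Finset.mem_filter.2 ⟨Finset.mem_ssubsets.2 hB, hA⟩)).trans hle
  · exact hmin Z (Finset.mem_filter.2 ⟨Finset.mem_ssubsets.2 hZ, hAY.trans hYZ⟩)

theorem intrinsicIn_refl (A : Finset M) : IntrinsicIn k α A A :=
  ⟨subset_rfl, fun _ h h' => absurd h h'.2⟩

/-- The relative predimension of `B` over `U` is at most that of `B` over `U ∩ B`. -/
theorem delta_union_sub_le (hα : ∀ i, 0 ≤ α i) (U B : Finset M) :
    delta k α (U ∪ B) - delta k α U ≤ delta k α B - delta k α (U ∩ B) := by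
  have := delta_union_add_delta_inter_le k α hα U B
  linarith

theorem IntrinsicIn.delta_lt_inter (hα : ∀ i, 0 ≤ α i) {A B U : Finset M}
    (h : IntrinsicIn k α A B) (hAU : A ⊆ U) (hBU : ¬ B ⊆ U) :
    delta k α B < delta k α (U ∩ B) :=
  ((intrinsicIn_iff_delta_lt hα).1 h).2 _ (Finset.subset_inter hAU h.1)
    ⟨Finset.inter_subset_right, fun hB => hBU (hB.trans Finset.inter_subset_left)⟩

theorem IntrinsicIn.union_left (hα : ∀ i, 0 ≤ α i) {A B U : Finset M}
    (h : IntrinsicIn k α A B) (hAU : A ⊆ U) : IntrinsicIn k α U (U ∪ B) := by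
  refine (intrinsicIn_iff_delta_lt hα).2 ⟨Finset.subset_union_left, fun A' hUA hA' => ?_⟩
  have hBA : ¬ B ⊆ A' := fun hB => hA'.2 (Finset.union_subset hUA hB)
  have hU : A' ∪ B = U ∪ B :=
    (Finset.union_subset hA'.1 Finset.subset_union_right).antisymm
      (Finset.union_subset_union_left hUA)
  have h₁ := h.delta_lt_inter hα (hAU.trans hUA) hBA
  have h₂ := delta_union_sub_le (k := k) hα A' B
  rw [hU] at h₂
  linarith

theorem IntrinsicIn.trans (hα : ∀ i, 0 ≤ α i) {A B D : Finset M}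
    (h : IntrinsicIn k α A B) (h' : IntrinsicIn k α B D) : IntrinsicIn k α A D := by
  refine (intrinsicIn_iff_delta_lt hα).2 ⟨h.1.trans h'.1, fun A' hA hD => ?_⟩
  by_cases hB : B ⊆ A'
  · exact ((intrinsicIn_iff_delta_lt hα).1 h').2 A' hB hD
  · have h₁ := h.delta_lt_inter hα hA hB
    have h₂ := delta_union_sub_le (k := k) hα A' B
    have h₃ : delta k α D ≤ delta k α (A' ∪ B) := by
      rcases (Finset.union_subset hD.1 h'.1).eq_or_ssubset with he | hs
      · rw [he]
      · exact (((intrinsicIn_iff_delta_lt hα).1 h').2 _ Finset.subset_union_right hs).le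
    linarith

/-- A greedy union of small intrinsic extensions of `A` inside its closure either exhausts the
closure after `N` steps or has decreased the predimension by at least `N * ε`. -/
theorem exists_intrinsicIn_cl_subset_or_delta_le (hα : ∀ i, 0 ≤ α i) {n : ℕ} {ε : ℝ}
    {A : Finset M}
    (hε : ∀ X Y : Finset M, X.card ≤ A.card + n → Y.card ≤ A.card + n →
      delta k α Y < delta k α X → delta k α Y + ε ≤ delta k α X) (N : ℕ) :
    ∃ U : Finset M, IntrinsicIn k α A U ∧ (U \ A).card ≤ N * n ∧ (U : Set M) ⊆ A ∪ cl k α n A ∧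
      (cl k α n A ⊆ U ∨ delta k α U + N * ε ≤ delta k α A) := by
  induction N with
  | zero => exact ⟨A, intrinsicIn_refl A, by simp, Set.subset_union_left, Or.inr (by simp)⟩
  | succ N ih =>
    obtain ⟨U, hAU, hcard, hUcl, hU⟩ := ih
    by_cases hcl : cl k α n A ⊆ U
    · exact ⟨U, hAU, hcard.trans (Nat.mul_le_mul_right n N.le_succ), hUcl, Or.inl hcl⟩
    replace hU := hU.resolve_left hcl
    obtain ⟨x, ⟨B, hAB, hBn, hxB⟩, hxU⟩ := Set.not_subset.1 hcl
    have hBU : ¬ B ⊆ U := fun h => hxU (h hxB)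
    have hBcard : B.card ≤ A.card + n := by
      have := Finset.card_sdiff_add_card_eq_card hAB.1
      omega
    refine ⟨U ∪ B, hAU.trans hα (hAB.union_left hα hAU.1), ?_, ?_, Or.inr ?_⟩
    · rw [Finset.union_sdiff_distrib]
      have := Finset.card_union_le (U \ A) (B \ A)
      rw [Nat.succ_mul]
      omega
    · rw [Finset.coe_union]
      exact Set.union_subset hUcl fun y hy => Or.inr ⟨B, hAB, hBn, hy⟩
    · have h₁ := hε (U ∩ B) B ((Finset.card_le_card Finset.inter_subset_right).trans hBcard)
        hBcard (hAB.delta_lt_inter hα hAU.1 hBU)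
      have h₂ := delta_union_sub_le (k := k) hα U B
      push_cast
      linarith

end IntrinsicExtension

theorem cl_cl_subset_cl (k : Fin p → ℕ) (α : Fin p → ℝ)
    (hα : ∀ i, 0 < α i ∧ α i ≤ 1) (c m n : ℕ) :
    ∃ q : ℕ, ∀ (M : Type*) [(Lang p k).Structure M], InK k α M →
      ∀ A : Finset M, A.card = c →
        ∀ C : Finset M, (↑C : Set M) = cl k α n A →
          cl k α m C ⊆ cl k α q A := by
  have hα₀ : ∀ i, 0 ≤ α i := fun i => (hα i).1.le
  obtain ⟨ε, hε, hgap⟩ := exists_pos_delta_add_le k α (c + n)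
  obtain ⟨N, hN⟩ := exists_nat_gt (c / ε)
  rw [div_lt_iff₀ hε] at hN
  refine ⟨N * n + m, fun M _ hM A hA C hC x => ?_⟩
  rintro ⟨D, hCD, hDm, hxD⟩
  obtain ⟨U, hAU, hUcard, hUcl, hU⟩ := exists_intrinsicIn_cl_subset_or_delta_le hα₀
    (fun X Y hX hY => hgap M X Y (hA ▸ hX) (hA ▸ hY)) N
  have hCU : C ⊆ U := by
    rw [← Finset.coe_subset, hC]
    refine hU.resolve_right fun h => ?_
    have h₁ := hM.2 U
    have h₂ := delta_le_card k α hα₀ A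
    rw [hA] at h₂
    linarith
  refine ⟨U ∪ D, hAU.trans hα₀ (hCD.union_left hα₀ hCU), ?_, Finset.mem_union_right _ hxD⟩
  have hsub : (U ∪ D) \ A ⊆ (U \ A) ∪ (D \ C) := by
    intro y hy
    simp only [Finset.mem_sdiff, Finset.mem_union] at hy ⊢
    by_cases hyU : y ∈ U
    · exact Or.inl ⟨hyU, hy.2⟩
    · exact Or.inr ⟨hy.1.resolve_left hyU, fun h => hyU (hCU h)⟩
  have h₁ := Finset.card_le_card hsub
  have h₂ := Finset.card_union_le (U \ A) (D \ C)
  omega
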